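/- arXiv:2312.11329 — 2 statements merged into one kernel-verified Lean document; each statement's English description precedes it below -/
import Mathlib

section
/- (Lemma 1, midpoint form.) Let z⁺ ∈ Z and D′ := D ∪ {z⁺}, and let f_D := (w^max_D + w^min_D)/2 and f_{D′} := (w^max_{D′} + w^min_{D′})/2 be the midpoint nominal models. Then the model update is bounded by the uncertainty level at the newly visited point: for every z ∈ ℝ^d, ‖f_{D′}(z) − f_D(z)‖ ≤ (1/2)·h_D(z⁺), where h_D(z⁺) := ‖w^max_D(z⁺) − w^min_D(z⁺)‖. -/
open scoped Classical

/-- Kinky-inference upper confidence bound (componentwise):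
`w^max_D(z)_i = min_{y ∈ D} (f_i(y) + q‖z − y‖^λ)`. -/
noncomputable def wmax {d n : ℕ} (f : EuclideanSpace ℝ (Fin d) → EuclideanSpace ℝ (Fin n))
    (q lam : ℝ) (D : Finset (EuclideanSpace ℝ (Fin d))) (hD : D.Nonempty)
    (z : EuclideanSpace ℝ (Fin d)) (i : Fin n) : ℝ :=
  D.inf' hD fun y => f y i + q * ‖z - y‖ ^ lam

/-- Kinky-inference lower confidence bound (componentwise):
`w^min_D(z)_i = max_{y ∈ D} (f_i(y) − q‖z − y‖^λ)`. -/
noncomputable def wmin {d n : ℕ} (f : EuclideanSpace ℝ (Fin d) → EuclideanSpace ℝ (Fin n))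
    (q lam : ℝ) (D : Finset (EuclideanSpace ℝ (Fin d))) (hD : D.Nonempty)
    (z : EuclideanSpace ℝ (Fin d)) (i : Fin n) : ℝ :=
  D.sup' hD fun y => f y i - q * ‖z - y‖ ^ lam

/-- The midpoint nominal model `f_D := (w^max_D + w^min_D)/2`, as a vector in `ℝ^n`. -/
noncomputable def fmidVec {d n : ℕ} (f : EuclideanSpace ℝ (Fin d) → EuclideanSpace ℝ (Fin n))
    (q lam : ℝ) (D : Finset (EuclideanSpace ℝ (Fin d))) (hD : D.Nonempty)
    (z : EuclideanSpace ℝ (Fin d)) : EuclideanSpace ℝ (Fin n) :=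
  (EuclideanSpace.equiv (Fin n) ℝ).symm fun i =>
    (wmax f q lam D hD z i + wmin f q lam D hD z i) / 2

/-- The uncertainty level `h_D(z) := ‖w^max_D(z) − w^min_D(z)‖` (Euclidean norm). -/
noncomputable def hunc {d n : ℕ} (f : EuclideanSpace ℝ (Fin d) → EuclideanSpace ℝ (Fin n))
    (q lam : ℝ) (D : Finset (EuclideanSpace ℝ (Fin d))) (hD : D.Nonempty)
    (z : EuclideanSpace ℝ (Fin d)) : ℝ :=
  ‖(EuclideanSpace.equiv (Fin n) ℝ).symm fun i =>
      wmax f q lam D hD z i - wmin f q lam D hD z i‖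

theorem EuclideanSpace.norm_le_norm_of_abs_le {n : ℕ} {x y : EuclideanSpace ℝ (Fin n)}
    (h : ∀ i, |x i| ≤ |y i|) : ‖x‖ ≤ ‖y‖ := by
  rw [EuclideanSpace.norm_eq, EuclideanSpace.norm_eq]
  exact Real.sqrt_le_sqrt <| Finset.sum_le_sum fun i _ =>
    pow_le_pow_left₀ (norm_nonneg _) (h i) 2

theorem mul_norm_sub_rpow_le {E : Type*} [SeminormedAddCommGroup E] {q lam : ℝ} (hq : 0 ≤ q)
    (hlam0 : 0 ≤ lam) (hlam1 : lam ≤ 1) (x y z : E) :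
    q * ‖x - z‖ ^ lam ≤ q * ‖x - y‖ ^ lam + q * ‖y - z‖ ^ lam := by
  rw [← mul_add]
  exact mul_le_mul_of_nonneg_left
    ((Real.rpow_le_rpow (norm_nonneg _) (norm_sub_le_norm_sub_add_norm_sub x y z) hlam0).trans
      (Real.rpow_add_le_add_rpow (norm_nonneg _) (norm_nonneg _) hlam0 hlam1)) hq

section ConfidenceBounds

variable {d n : ℕ} {f : EuclideanSpace ℝ (Fin d) → EuclideanSpace ℝ (Fin n)} {q lam : ℝ}
  {D : Finset (EuclideanSpace ℝ (Fin d))}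

theorem wmax_insert (hD : D.Nonempty) (x z : EuclideanSpace ℝ (Fin d)) (i : Fin n) :
    wmax f q lam (insert x D) (Finset.insert_nonempty _ _) z i =
      min (f x i + q * ‖z - x‖ ^ lam) (wmax f q lam D hD z i) :=
  Finset.inf'_insert hD _

theorem wmin_insert (hD : D.Nonempty) (x z : EuclideanSpace ℝ (Fin d)) (i : Fin n) :
    wmin f q lam (insert x D) (Finset.insert_nonempty _ _) z i =
      max (f x i - q * ‖z - x‖ ^ lam) (wmin f q lam D hD z i) :=
  Finset.sup'_insert hD _

theorem wmax_le_wmax_add (hq : 0 ≤ q) (hlam0 : 0 ≤ lam) (hlam1 : lam ≤ 1) (hD : D.Nonempty)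
    (x z : EuclideanSpace ℝ (Fin d)) (i : Fin n) :
    wmax f q lam D hD z i ≤ wmax f q lam D hD x i + q * ‖z - x‖ ^ lam := by
  rw [← sub_le_iff_le_add]
  refine Finset.le_inf' _ _ fun y hy => ?_
  have hle : wmax f q lam D hD z i ≤ f y i + q * ‖z - y‖ ^ lam := Finset.inf'_le _ hy
  linarith [mul_norm_sub_rpow_le hq hlam0 hlam1 z x y]

theorem wmin_sub_le_wmin (hq : 0 ≤ q) (hlam0 : 0 ≤ lam) (hlam1 : lam ≤ 1) (hD : D.Nonempty)
    (x z : EuclideanSpace ℝ (Fin d)) (i : Fin n) :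
    wmin f q lam D hD x i - q * ‖z - x‖ ^ lam ≤ wmin f q lam D hD z i := by
  rw [sub_le_iff_le_add]
  refine Finset.sup'_le _ _ fun y hy => ?_
  have hle : f y i - q * ‖z - y‖ ^ lam ≤ wmin f q lam D hD z i :=
    Finset.le_sup' (fun y => f y i - q * ‖z - y‖ ^ lam) hy
  linarith [mul_norm_sub_rpow_le hq hlam0 hlam1 z x y]

theorem apply_le_wmax (hD : D.Nonempty) {x : EuclideanSpace ℝ (Fin d)}
    (hf : ∀ y ∈ D, ‖f x - f y‖ ≤ q * ‖x - y‖ ^ lam) (i : Fin n) :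
    f x i ≤ wmax f q lam D hD x i := by
  refine Finset.le_inf' _ _ fun y hy => ?_
  have hi : |f x i - f y i| ≤ ‖f x - f y‖ := PiLp.norm_apply_le (f x - f y) i
  linarith [hf y hy, le_abs_self (f x i - f y i)]

theorem wmin_le_apply (hD : D.Nonempty) {x : EuclideanSpace ℝ (Fin d)}
    (hf : ∀ y ∈ D, ‖f x - f y‖ ≤ q * ‖x - y‖ ^ lam) (i : Fin n) :
    wmin f q lam D hD x i ≤ f x i := by
  refine Finset.sup'_le _ _ fun y hy => ?_
  have hi : |f x i - f y i| ≤ ‖f x - f y‖ := PiLp.norm_apply_le (f x - f y) i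
  linarith [hf y hy, neg_abs_le (f x i - f y i)]

end ConfidenceBounds

/-- Lemma 1, midpoint form: with `z⁺ ∈ Z` and `D′ := D ∪ {z⁺}`, the
midpoint-model update is bounded by the uncertainty level at the newly visited point:
`‖f_{D′}(z) − f_D(z)‖ ≤ (1/2)·h_D(z⁺)` for every `z ∈ ℝ^d`. -/
theorem kinky_midpoint_update_bound (d n : ℕ) (Z : Set (EuclideanSpace ℝ (Fin d)))
    (f : EuclideanSpace ℝ (Fin d) → EuclideanSpace ℝ (Fin n)) (q lam : ℝ)
    (hq : 0 < q) (hlam0 : 0 < lam) (hlam1 : lam ≤ 1)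
    (hf : ∀ z₁ ∈ Z, ∀ z₂ ∈ Z, ‖f z₁ - f z₂‖ ≤ q * ‖z₁ - z₂‖ ^ lam)
    (D : Finset (EuclideanSpace ℝ (Fin d))) (hD : D.Nonempty) (hDZ : ↑D ⊆ Z)
    (zplus : EuclideanSpace ℝ (Fin d)) (hzplus : zplus ∈ Z) :
    ∀ z : EuclideanSpace ℝ (Fin d),
      ‖fmidVec f q lam (insert zplus D) (Finset.insert_nonempty _ _) z -
          fmidVec f q lam D hD z‖ ≤ (1 / 2) * hunc f q lam D hD zplus := by
  intro z
  have hfD : ∀ y ∈ D, ‖f zplus - f y‖ ≤ q * ‖zplus - y‖ ^ lam :=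
    fun y hy => hf zplus hzplus y (hDZ hy)
  have hhalf : (1 / 2 : ℝ) = ‖(1 / 2 : ℝ)‖ := by norm_num
  rw [hunc, hhalf, ← norm_smul]
  refine EuclideanSpace.norm_le_norm_of_abs_le fun i => ?_
  change |(wmax f q lam (insert zplus D) _ z i + wmin f q lam (insert zplus D) _ z i) / 2 -
      (wmax f q lam D hD z i + wmin f q lam D hD z i) / 2| ≤
    |1 / 2 * (wmax f q lam D hD zplus i - wmin f q lam D hD zplus i)|
  rw [wmax_insert hD, wmin_insert hD]
  have hmax := wmax_le_wmax_add (f := f) hq.le hlam0.le hlam1 hD zplus z i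
  have hmin := wmin_sub_le_wmin (f := f) hq.le hlam0.le hlam1 hD zplus z i
  have hle_max := apply_le_wmax hD hfD i
  have hmin_le := wmin_le_apply hD hfD i
  refine le_trans ?_ (le_abs_self _)
  rw [abs_le]
  constructor <;>
    rcases min_cases (f zplus i + q * ‖z - zplus‖ ^ lam) (wmax f q lam D hD z i) with h | h <;>
    rcases max_cases (f zplus i - q * ‖z - zplus‖ ^ lam) (wmin f q lam D hD z i) with h' | h' <;>
    linarith
end

section
/- The uncertainty level has a uniform Hölder modulus of continuity independent of the data set: for all z, y ∈ ℝ^d, |h_D(z) − h_D(y)| ≤ 2q√n·‖z − y‖^λ, where h_D(z) := ‖w^max_D(z) − w^min_D(z)‖. -/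
theorem norm_sub_rpow_le_add {E : Type*} [SeminormedAddCommGroup E] {r : ℝ} (hr0 : 0 ≤ r)
    (hr1 : r ≤ 1) (x y z : E) : ‖x - z‖ ^ r ≤ ‖x - y‖ ^ r + ‖y - z‖ ^ r :=
  (Real.rpow_le_rpow (norm_nonneg _) (norm_sub_le_norm_sub_add_norm_sub x y z) hr0).trans
    (Real.rpow_add_le_add_rpow (norm_nonneg _) (norm_nonneg _) hr0 hr1)

theorem wmax_le_add {d n : ℕ} (f : EuclideanSpace ℝ (Fin d) → EuclideanSpace ℝ (Fin n))
    {q lam : ℝ} (hq : 0 ≤ q) (hlam0 : 0 ≤ lam) (hlam1 : lam ≤ 1)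
    (D : Finset (EuclideanSpace ℝ (Fin d))) (hD : D.Nonempty)
    (z y : EuclideanSpace ℝ (Fin d)) (i : Fin n) :
    wmax f q lam D hD z i ≤ wmax f q lam D hD y i + q * ‖z - y‖ ^ lam := by
  rw [← sub_le_iff_le_add]
  refine Finset.le_inf' _ _ fun x hx => ?_
  have h := mul_le_mul_of_nonneg_left (norm_sub_rpow_le_add hlam0 hlam1 z y x) hq
  have h' : wmax f q lam D hD z i ≤ f x i + q * ‖z - x‖ ^ lam :=
    Finset.inf'_le (fun x => f x i + q * ‖z - x‖ ^ lam) hx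
  linarith

theorem wmin_eq_neg_wmax_neg {d n : ℕ}
    (f : EuclideanSpace ℝ (Fin d) → EuclideanSpace ℝ (Fin n)) (q lam : ℝ)
    (D : Finset (EuclideanSpace ℝ (Fin d))) (hD : D.Nonempty)
    (z : EuclideanSpace ℝ (Fin d)) (i : Fin n) :
    wmin f q lam D hD z i = -wmax (-f) q lam D hD z i := by
  apply le_antisymm
  · refine Finset.sup'_le _ _ fun x hx => ?_
    have h : wmax (-f) q lam D hD z i ≤ (-f) x i + q * ‖z - x‖ ^ lam :=
      Finset.inf'_le (fun x => (-f) x i + q * ‖z - x‖ ^ lam) hx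
    simp only [Pi.neg_apply, PiLp.neg_apply] at h
    linarith
  · rw [neg_le]
    refine Finset.le_inf' _ _ fun x hx => ?_
    have h : f x i - q * ‖z - x‖ ^ lam ≤ wmin f q lam D hD z i :=
      Finset.le_sup' (fun x => f x i - q * ‖z - x‖ ^ lam) hx
    simp only [Pi.neg_apply, PiLp.neg_apply]
    linarith

theorem EuclideanSpace.norm_le_sqrt_card_mul {ι : Type*} [Fintype ι] (v : EuclideanSpace ℝ ι)
    {c : ℝ} (hc : 0 ≤ c) (hv : ∀ i, |v i| ≤ c) : ‖v‖ ≤ √(Fintype.card ι) * c := by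
  rw [EuclideanSpace.norm_eq, ← Real.sqrt_sq hc, ← Real.sqrt_mul (Nat.cast_nonneg _)]
  refine Real.sqrt_le_sqrt ((Finset.sum_le_card_nsmul _ _ (c ^ 2) fun i _ => ?_).trans_eq ?_)
  · exact pow_le_pow_left₀ (norm_nonneg _) (hv i) 2
  · simp

/-- The uncertainty level has a uniform Hölder modulus of continuity
independent of the data set: `|h_D(z) − h_D(y)| ≤ 2q√n·‖z − y‖^λ` for all `z, y ∈ ℝ^d`. -/
theorem kinky_uncertainty_holder (d n : ℕ) (Z : Set (EuclideanSpace ℝ (Fin d)))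
    (f : EuclideanSpace ℝ (Fin d) → EuclideanSpace ℝ (Fin n)) (q lam : ℝ)
    (hq : 0 < q) (hlam0 : 0 < lam) (hlam1 : lam ≤ 1)
    (hf : ∀ z₁ ∈ Z, ∀ z₂ ∈ Z, ‖f z₁ - f z₂‖ ≤ q * ‖z₁ - z₂‖ ^ lam)
    (D : Finset (EuclideanSpace ℝ (Fin d))) (hD : D.Nonempty) (hDZ : ↑D ⊆ Z) :
    ∀ z y : EuclideanSpace ℝ (Fin d),
      |hunc f q lam D hD z - hunc f q lam D hD y| ≤
        2 * q * Real.sqrt n * ‖z - y‖ ^ lam := by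
  intro z y
  have hc : 0 ≤ 2 * q * ‖z - y‖ ^ lam := by positivity
  refine (abs_norm_sub_norm_le _ _).trans ((EuclideanSpace.norm_le_sqrt_card_mul _ hc ?_).trans_eq
    (by rw [Fintype.card_fin]; ring))
  intro i
  have h₁ := wmax_le_add f hq.le hlam0.le hlam1 D hD z y i
  have h₂ := wmax_le_add f hq.le hlam0.le hlam1 D hD y z i
  have h₃ := wmax_le_add (-f) hq.le hlam0.le hlam1 D hD z y i
  have h₄ := wmax_le_add (-f) hq.le hlam0.le hlam1 D hD y z i
  rw [norm_sub_rev y z] at h₂ h₄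
  change |(wmax f q lam D hD z i - wmin f q lam D hD z i) -
    (wmax f q lam D hD y i - wmin f q lam D hD y i)| ≤ _
  rw [wmin_eq_neg_wmax_neg, wmin_eq_neg_wmax_neg, abs_le]
  constructor <;> linarith
end
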